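/- Let K be a field and let f ∈ S = K[x₁,…,xₙ] be a polynomial whose leading term lt(f) with respect to a fixed term order ≺ is a squarefree monomial. If I, J ∈ C_f, then lt(I + J) = lt(I) + lt(J); equivalently, the union of a Gröbner basis of I and a Gröbner basis of J is a Gröbner basis of I + J. -/

import Mathlib

open MvPolynomial

/-- The leading exponent (degree) of a multivariate polynomial with respect to a
monomial order: the maximum of its support. -/
noncomputable def MonomialOrder.degreeOf {σ : Type*} {K : Type*} [CommSemiring K]
    (m : MonomialOrder σ) (f : MvPolynomial σ K) : σ →₀ ℕ :=
  m.toSyn.symm (f.support.sup m.toSyn)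

/-- The leading term `lt(f)` of a polynomial with respect to a monomial order. -/
noncomputable def MonomialOrder.leadTerm {σ : Type*} {K : Type*} [CommSemiring K]
    (m : MonomialOrder σ) (f : MvPolynomial σ K) : MvPolynomial σ K :=
  monomial (m.degreeOf f) (f.coeff (m.degreeOf f))

/-- The initial ideal `lt(I)` of an ideal, generated by leading terms of its
nonzero elements. -/
noncomputable def MonomialOrder.initialIdeal {σ : Type*} {K : Type*} [CommSemiring K]
    (m : MonomialOrder σ) (I : Ideal (MvPolynomial σ K)) : Ideal (MvPolynomial σ K) :=
  Ideal.span { g | ∃ f ∈ I, f ≠ 0 ∧ g = m.leadTerm f }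

/-- The leading term of `f` is a squarefree monomial. -/
def MonomialOrder.HasSqfreeLeadTerm {σ : Type*} {K : Type*} [CommSemiring K]
    (m : MonomialOrder σ) (f : MvPolynomial σ K) : Prop :=
  f ≠ 0 ∧ ∀ i, m.degreeOf f i ≤ 1

/-- The family `C_f` of Knutson ideals associated to `f` : the smallest family of ideals
containing `(f)`, closed under colon by arbitrary ideals, sums and intersections. -/
inductive KnutsonFamily {σ : Type*} {K : Type*} [Field K] (f : MvPolynomial σ K) :
    Ideal (MvPolynomial σ K) → Prop
  | base : KnutsonFamily f (Ideal.span {f})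
  | colon (I J : Ideal (MvPolynomial σ K)) : KnutsonFamily f I → KnutsonFamily f (I.colon J)
  | add (I J : Ideal (MvPolynomial σ K)) :
      KnutsonFamily f I → KnutsonFamily f J → KnutsonFamily f (I + J)
  | inter (I J : Ideal (MvPolynomial σ K)) :
      KnutsonFamily f I → KnutsonFamily f J → KnutsonFamily f (I ⊓ J)

/-- A squarefree monomial ideal : an ideal generated by squarefree monomials. -/
def IsSqfreeMonomialIdeal {σ : Type*} {K : Type*} [CommSemiring K]
    (J : Ideal (MvPolynomial σ K)) : Prop :=
  ∃ G : Set (MvPolynomial σ K),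
    (∀ g ∈ G, ∃ s : Finset σ, g = ∏ i ∈ s, X i) ∧ J = Ideal.span G

universe u

namespace KnutsonAux

variable {n : ℕ}

/-- `g` is monic with leading exponent `D`. -/
def Mon (m : MonomialOrder (Fin n)) {R : Type*} [CommRing R] (D : Fin n →₀ ℕ)
    (g : MvPolynomial (Fin n) R) : Prop :=
  coeff D g = 1 ∧ m.toSyn (m.degree g) ≤ m.toSyn D

section mon
variable {m : MonomialOrder (Fin n)} {R S : Type*} [CommRing R] [CommRing S]

lemma Mon.degree_eq [Nontrivial R] {D} {g : MvPolynomial (Fin n) R} (h : Mon m D g) :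
    m.degree g = D := by
  apply m.toSyn.injective
  apply le_antisymm h.2
  apply m.le_degree
  rw [mem_support_iff, h.1]
  exact one_ne_zero

lemma Mon.mul {D E} {g h : MvPolynomial (Fin n) R} (hg : Mon m D g) (hh : Mon m E h) :
    Mon m (D + E) (g * h) := by
  refine ⟨?_, ?_⟩
  · rw [m.coeff_mul_of_add_of_degree_le hg.2 hh.2, hg.1, hh.1, one_mul]
  · refine le_trans m.degree_mul_le ?_
    rw [map_add, map_add]
    exact add_le_add hg.2 hh.2

lemma mon_monomial (D) : Mon m D (monomial D (1 : R)) :=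
  ⟨by simp, m.degree_monomial_le _⟩

lemma Mon.pow {D} {g : MvPolynomial (Fin n) R} (hg : Mon m D g) (k : ℕ) :
    Mon m (k • D) (g ^ k) := by
  induction k with
  | zero => simpa using mon_monomial (m := m) (R := R) 0
  | succ k ih => rw [pow_succ, succ_nsmul]; exact ih.mul hg

lemma Mon.map {D} {g : MvPolynomial (Fin n) R} (hg : Mon m D g) (φ : R →+* S) :
    Mon m D (MvPolynomial.map φ g) := by
  refine ⟨by rw [coeff_map, hg.1, map_one], ?_⟩
  rw [m.degree_le_iff]
  intro c hc
  exact m.degree_le_iff.1 hg.2 c (support_map_subset _ _ hc)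

lemma Mon.of_map {D} {g : MvPolynomial (Fin n) R} (φ : R →+* S) (hφ : Function.Injective φ)
    (hg : Mon m D (MvPolynomial.map φ g)) : Mon m D g := by
  refine ⟨hφ (by rw [← coeff_map, hg.1, map_one]), ?_⟩
  rw [m.degree_le_iff]
  intro c hc
  apply m.degree_le_iff.1 hg.2 c
  rw [mem_support_iff, coeff_map]
  rw [mem_support_iff] at hc
  exact fun h => hc (hφ (by rw [h, map_zero]))

lemma exists_mon {K : Type*} [Field K] {g : MvPolynomial (Fin n) K} (hg : g ≠ 0) :
    Mon m (m.degree g) (C (coeff (m.degree g) g)⁻¹ * g) := by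
  have h0 : coeff (m.degree g) g ≠ 0 := m.coeff_degree_ne_zero_iff.2 hg
  refine ⟨by rw [coeff_C_mul, inv_mul_cancel₀ h0], ?_⟩
  rw [m.degree_le_iff]
  intro c hc
  apply m.le_degree
  rw [mem_support_iff, coeff_C_mul] at hc
  rw [mem_support_iff]
  exact right_ne_zero_of_mul hc

/-- Linear division with remainder. -/
lemma lin_div [Nontrivial R] {r : ℕ} (b : Fin r → MvPolynomial (Fin n) R)
    (E : Fin r → (Fin n →₀ ℕ)) (hb : ∀ i, Mon m (E i) (b i)) :
    ∃ (Q : Fin r → (Fin n →₀ ℕ) → MvPolynomial (Fin n) R)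
      (N : (Fin n →₀ ℕ) → MvPolynomial (Fin n) R),
      (∀ c, monomial c 1 = ∑ i, Q i c * b i + N c) ∧
      (∀ c, ∀ d ∈ (N c).support, ∀ i, ¬ E i ≤ d) ∧
      (∀ c, ∀ d ∈ (N c).support, m.toSyn d ≤ m.toSyn c) ∧
      (∀ c, (∀ i, ¬ E i ≤ c) → N c = monomial c 1) := by
  have key : ∀ c, ∃ (Q : Fin r → MvPolynomial (Fin n) R) (N : MvPolynomial (Fin n) R),
      (monomial c 1 = ∑ i, Q i * b i + N) ∧ (∀ d ∈ N.support, ∀ i, ¬ E i ≤ d) ∧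
      (∀ d ∈ N.support, m.toSyn d ≤ m.toSyn c) ∧
      ((∀ i, ¬ E i ≤ c) → N = monomial c 1) := by
    intro c
    by_cases hc : ∀ i, ¬ E i ≤ c
    · refine ⟨fun _ => 0, monomial c 1, by simp, ?_, ?_, fun _ => rfl⟩
      · intro d hd
        have := support_monomial_subset hd
        rw [Finset.mem_singleton] at this
        rwa [this]
      · intro d hd
        have := support_monomial_subset hd
        rw [Finset.mem_singleton] at this
        rw [this]
    · obtain ⟨g, N, h1, h2, h3⟩ := m.div (b := b) (fun i => by
        rw [MonomialOrder.leadingCoeff, (hb i).degree_eq, (hb i).1]; exact isUnit_one)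
        (monomial c (1 : R))
      have h1' : monomial c (1 : R) = ∑ i, g i * b i + N := by
        rw [h1, Finsupp.linearCombination_apply, Finsupp.sum_fintype]
        · simp
        · simp
      refine ⟨g, N, h1', ?_, ?_, fun h => absurd h hc⟩
      · intro d hd i
        rw [← (hb i).degree_eq]
        exact h3 d hd i
      · have hN : N = monomial c (1 : R) - ∑ i, g i * b i := by rw [h1']; ring
        intro d hd
        refine m.degree_le_iff.1 (?_ : m.toSyn (m.degree N) ≤ m.toSyn c) d hd
        have hc' : m.toSyn (m.degree (monomial c (1 : R))) ≤ m.toSyn c := m.degree_monomial_le _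
        rw [m.degree_le_iff]
        intro d hd
        by_contra hlt
        rw [not_le] at hlt
        rw [mem_support_iff] at hd
        apply hd
        rw [hN, coeff_sub, coeff_sum, m.coeff_eq_zero_of_lt (hc'.trans_lt hlt), zero_sub,
          neg_eq_zero]
        apply Finset.sum_eq_zero
        intro i _
        apply m.coeff_eq_zero_of_lt
        rw [mul_comm]
        exact (h2 i).trans_lt (hc'.trans_lt hlt)
  choose Q N h1 h2 h3 h4 using key
  exact ⟨fun i c => Q c i, N, h1, h2, h3, h4⟩

end mon

/-- Finite Groebner bases exist. -/
lemma exists_gb (m : MonomialOrder (Fin n)) {K : Type*} [Field K]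
    (L : Ideal (MvPolynomial (Fin n) K)) :
    ∃ (r : ℕ) (h : Fin r → MvPolynomial (Fin n) K) (E : Fin r → (Fin n →₀ ℕ)),
      (∀ i, h i ∈ L) ∧ (∀ i, Mon m (E i) (h i)) ∧
      ∀ g ∈ L, g ≠ 0 → ∃ i, E i ≤ m.degree g := by
  let Δ : Set (Fin n →₀ ℕ) := {d | ∃ g ∈ L, g ≠ 0 ∧ m.degree g = d}
  have hfin : {d | Minimal (· ∈ Δ) d}.Finite := by
    apply WellQuasiOrderedLE.finite_of_isAntichain
    exact setOfPred_minimal_antichain _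
  obtain ⟨r, E, hE⟩ : ∃ (r : ℕ) (E : Fin r → (Fin n →₀ ℕ)),
      Set.range E = {d | Minimal (· ∈ Δ) d} := by
    have := hfin.to_subtype
    obtain ⟨r, ⟨e⟩⟩ := Finite.exists_equiv_fin {d | Minimal (· ∈ Δ) d}
    refine ⟨r, fun i => (e.symm i).1, ?_⟩
    ext x
    constructor
    · rintro ⟨i, rfl⟩
      exact (e.symm i).2
    · intro hx
      exact ⟨e ⟨x, hx⟩, by simp⟩
  have hE' : ∀ i, ∃ h ∈ L, Mon m (E i) h := by
    intro i
    have : E i ∈ {d | Minimal (· ∈ Δ) d} := hE ▸ ⟨i, rfl⟩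
    obtain ⟨g, hg, h0, hd⟩ := this.prop
    refine ⟨_, L.mul_mem_left (C (coeff (m.degree g) g)⁻¹) hg, ?_⟩
    rw [← hd]
    exact exists_mon h0
  choose h hh1 hh2 using hE'
  refine ⟨r, h, E, hh1, hh2, ?_⟩
  intro g hg h0
  obtain ⟨d, hd1, hd2⟩ := exists_minimal_le_of_wellFoundedLT (· ∈ Δ) (m.degree g) ⟨g, hg, h0, rfl⟩
  have : d ∈ Set.range E := hE ▸ hd2
  obtain ⟨i, rfl⟩ := this
  exact ⟨i, hd1⟩


/-- A reduction to positive characteristic of a finitely generated subring of `K`. -/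
structure Red (K : Type u) [Field K] where
  A : Type u
  k : Type u
  [ringA : CommRing A]
  [ringk : CommRing k]
  [ntk : Nontrivial k]
  incl : A →+* K
  inj : Function.Injective incl
  red : A →+* k
  surj : Function.Surjective red
  p : ℕ
  hp : p.Prime
  charP : CharP k p
  root : k →+ k
  root_mul : ∀ c d, root (c ^ p * d) = c * root d
  root_one : root 1 = 1

attribute [instance] Red.ringA Red.ringk Red.ntk

lemma jacobson_int : IsJacobsonRing ℤ := by
  rw [isJacobsonRing_iff_prime_eq]
  intro P hP
  by_cases h : P = ⊥
  · subst h
    rw [eq_bot_iff]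
    intro x hx
    rw [Ideal.mem_jacobson_bot] at hx
    have h1 := hx (3 * x)
    rw [Ideal.mem_bot]
    by_contra h0
    have : 0 < x * x := mul_self_pos.2 h0
    rcases Int.isUnit_iff.1 h1 with h2 | h2 <;> nlinarith
  · have := hP.isMaximal h
    exact Ideal.jacobson_eq_self_of_isMaximal

lemma finite_field (k : Type*) [CommRing k] (hk : IsField k) [inst : Algebra ℤ k]
    [Algebra.FiniteType ℤ k] : ∃ p : ℕ, p.Prime ∧ CharP k p ∧ Finite k := by
  obtain rfl : inst = Ring.toIntAlgebra k := Subsingleton.elim _ _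
  let _ : Field k := hk.toField
  have := jacobson_int
  have : Module.Finite ℤ k := finite_of_finite_type_of_isJacobsonRing ℤ k
  obtain ⟨p, hp⟩ := CharP.exists k
  have hp0 : p ≠ 0 := by
    rintro rfl
    have : CharZero k := CharP.charP_to_charZero _
    have hint : Algebra.IsIntegral ℤ k := inferInstance
    have := isField_of_isIntegral_of_isField (R := ℤ) (S := k)
      (by
        intro a b h
        simpa using h) (Field.toIsField _)
    exact Int.not_isField this
  refine ⟨p, (CharP.char_is_prime_or_zero k p).resolve_right hp0, hp, ?_⟩
  apply Module.finite_of_fg_torsion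
  intro x
  refine ⟨⟨(p : ℤ), ?_⟩, ?_⟩
  · rw [mem_nonZeroDivisors_iff_ne_zero]; exact_mod_cast hp0
  · change (p : ℤ) • x = 0
    simp

lemma finite_field_root (k : Type*) [CommRing k] (hk : IsField k) [Algebra ℤ k]
    [Algebra.FiniteType ℤ k] : ∃ p : ℕ, p.Prime ∧ CharP k p ∧ ∃ root : k →+ k,
      (∀ c d, root (c ^ p * d) = c * root d) ∧ root 1 = 1 := by
  obtain ⟨p, hprime, hp, _⟩ := finite_field k hk
  have : Fact p.Prime := ⟨hprime⟩
  have : IsDomain k := hk.isDomain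
  have : PerfectRing k p := PerfectRing.ofFiniteOfIsReduced p _
  refine ⟨p, hprime, hp, ((frobeniusEquiv k p).symm : k ≃+* k).toRingHom.toAddMonoidHom, ?_, ?_⟩
  · intro c d
    simp
  · simp

lemma exists_red {K : Type u} [Field K] (T : Finset K) :
    ∃ R : Red K, ∀ t ∈ T, t ∈ R.incl.range := by
  let A := Algebra.adjoin ℤ (T : Set K)
  have : Algebra.FiniteType ℤ A := Algebra.FiniteType.adjoin_of_finite T.finite_toSet
  obtain ⟨M, hM⟩ := Ideal.exists_maximal A
  have hft : Algebra.FiniteType ℤ (A ⧸ M) :=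
    Algebra.FiniteType.of_surjective (Ideal.Quotient.mkₐ ℤ M) Ideal.Quotient.mk_surjective
  have hF := (Ideal.Quotient.maximal_ideal_iff_isField_quotient M).1 hM
  obtain ⟨p, hprime, hp, root, h1, h2⟩ := @finite_field_root (A ⧸ M) _ hF _ hft
  exact ⟨{ A := A, k := A ⧸ M, incl := A.val.toRingHom, inj := Subtype.val_injective,
           ntk := hF.nontrivial,
           red := Ideal.Quotient.mk M, surj := Ideal.Quotient.mk_surjective, p := p,
           hp := hprime, charP := hp, root := root, root_mul := h1, root_one := h2 },
    fun t ht => ⟨⟨t, Algebra.subset_adjoin ht⟩, rfl⟩⟩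

section trace
variable {K : Type u} [Field K] (R : Red K)

/-- The map `b ↦ p b + (p - 1)`. -/
noncomputable def shift (n p : ℕ) (b : Fin n →₀ ℕ) : Fin n →₀ ℕ :=
  p • b + (p - 1) • Finsupp.equivFunOnFinite.symm (fun _ => 1)

lemma shift_apply (p : ℕ) (b : Fin n →₀ ℕ) (i) : shift n p b i = p * b i + (p - 1) := by
  simp [shift]

lemma shift_inj {p : ℕ} (hp : p.Prime) : Function.Injective (shift n p) := by
  intro a b h
  ext i
  have := DFunLike.congr_fun h i
  rw [shift_apply, shift_apply] at this
  exact Nat.eq_of_mul_eq_mul_left hp.pos (by omega)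

/-- The trace map. -/
noncomputable def tr (g : MvPolynomial (Fin n) R.k) : MvPolynomial (Fin n) R.k :=
  ∑ b ∈ g.support.preimage (shift n R.p) (shift_inj R.hp).injOn,
    monomial b (R.root (coeff (shift n R.p b) g))

lemma coeff_tr (g : MvPolynomial (Fin n) R.k) (b) :
    coeff b (tr R g) = R.root (coeff (shift n R.p b) g) := by
  classical
  rw [tr, coeff_sum]
  simp only [coeff_monomial]
  rw [Finset.sum_ite_eq']
  split_ifs with h
  · rfl
  · rw [Finset.mem_preimage, mem_support_iff, not_not] at h
    rw [h, map_zero]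

lemma tr_add (g h : MvPolynomial (Fin n) R.k) : tr R (g + h) = tr R g + tr R h := by
  ext b
  simp [coeff_tr]

lemma tr_pow_mul (h g : MvPolynomial (Fin n) R.k) : tr R (h ^ R.p * g) = h * tr R g := by
  have := R.charP
  have : Fact R.p.Prime := ⟨R.hp⟩
  have : CharP (MvPolynomial (Fin n) R.k) R.p := inferInstance
  induction h using MvPolynomial.induction_on' with
  | add a b ha hb =>
    rw [add_pow_char, add_mul, tr_add, ha, hb, add_mul]
  | monomial d c =>
    ext b
    rw [coeff_tr, monomial_pow, coeff_monomial_mul', coeff_monomial_mul', coeff_tr]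
    have hp := R.hp.pos
    have iff1 : R.p • d ≤ shift n R.p b ↔ d ≤ b := by
      rw [Finsupp.le_def, Finsupp.le_def]
      refine forall_congr' fun i => ?_
      rw [shift_apply, Finsupp.smul_apply, smul_eq_mul]
      constructor
      · intro h
        by_contra hlt
        have : R.p * (b i + 1) ≤ R.p * d i := Nat.mul_le_mul_left _ (by omega)
        rw [mul_add] at this
        omega
      · intro h
        have : R.p * d i ≤ R.p * b i := Nat.mul_le_mul_left _ h
        omega
    by_cases hdb : d ≤ b
    · rw [if_pos hdb, if_pos (iff1.2 hdb), R.root_mul]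
      congr 3
      ext i
      rw [Finsupp.tsub_apply, shift_apply, shift_apply, Finsupp.tsub_apply, Finsupp.smul_apply,
        smul_eq_mul, Nat.mul_sub]
      have : R.p * d i ≤ R.p * b i := Nat.mul_le_mul_left _ (hdb i)
      omega
    · rw [if_neg hdb, if_neg (fun h => hdb (iff1.1 h)), map_zero]

lemma tr_mon {m : MonomialOrder (Fin n)} {F G : MvPolynomial (Fin n) R.k} {D : Fin n →₀ ℕ}
    (hF : Mon m (Finsupp.equivFunOnFinite.symm (fun _ => 1)) F) (hG : Mon m (R.p • D) G) :
    Mon m D (tr R (F ^ (R.p - 1) * G)) := by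
  have h := (hF.pow (R.p - 1)).mul hG
  have e : ∀ b : Fin n →₀ ℕ, shift n R.p b
      = (R.p - 1) • Finsupp.equivFunOnFinite.symm (fun _ => 1) + R.p • b :=
    fun b => add_comm _ _
  refine ⟨?_, ?_⟩
  · rw [coeff_tr, e, h.1, R.root_one]
  · rw [m.degree_le_iff]
    intro b hb
    rw [mem_support_iff, coeff_tr, e] at hb
    by_contra hlt
    rw [not_le] at hlt
    apply hb
    rw [m.coeff_eq_zero_of_lt, map_zero]
    refine h.2.trans_lt ?_
    rw [map_add, map_add, map_nsmul _ _ D, map_nsmul _ _ b]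
    have := nsmul_lt_nsmul_right R.hp.ne_zero hlt
    exact add_lt_add_right this _

end trace

section ev
variable {K : Type u} [Field K]

/-- Eventual truth along reductions. -/
def Ev (P : Red K → Prop) : Prop :=
  ∃ T : Finset K, ∀ R : Red K, (∀ t ∈ T, t ∈ R.incl.range) → P R

lemma Ev.and {P Q : Red K → Prop} (hP : Ev P) (hQ : Ev Q) : Ev fun R => P R ∧ Q R := by
  classical
  obtain ⟨T, hT⟩ := hP
  obtain ⟨T', hT'⟩ := hQ
  exact ⟨T ∪ T', fun R h => ⟨hT R fun t ht => h t (Finset.mem_union_left _ ht),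
    hT' R fun t ht => h t (Finset.mem_union_right _ ht)⟩⟩

lemma Ev.mono {P Q : Red K → Prop} (hP : Ev P) (h : ∀ R, P R → Q R) : Ev Q := by
  obtain ⟨T, hT⟩ := hP
  exact ⟨T, fun R hR => h R (hT R hR)⟩

lemma Ev.exists {P : Red K → Prop} (hP : Ev P) : ∃ R, P R := by
  obtain ⟨T, hT⟩ := hP
  obtain ⟨R, hR⟩ := exists_red T
  exact ⟨R, hT R hR⟩

lemma Ev.forall {r : ℕ} {P : Fin r → Red K → Prop} (hP : ∀ i, Ev (P i)) :
    Ev fun R => ∀ i, P i R := by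
  classical
  choose T hT using hP
  exact ⟨Finset.univ.biUnion T, fun R hR i => hT i R fun t ht =>
    hR t (Finset.mem_biUnion.2 ⟨i, Finset.mem_univ _, ht⟩)⟩

/-- extension to polynomials -/
noncomputable abbrev inc (n : ℕ) (R : Red K) : MvPolynomial (Fin n) R.A →+* MvPolynomial (Fin n) K :=
  MvPolynomial.map R.incl

/-- reduction of polynomials -/
noncomputable abbrev rd (n : ℕ) (R : Red K) : MvPolynomial (Fin n) R.A →+* MvPolynomial (Fin n) R.k :=
  MvPolynomial.map R.red

lemma inc_inj (R : Red K) : Function.Injective (inc n R) := map_injective _ R.inj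

lemma rd_surj (R : Red K) : Function.Surjective (rd n R) := map_surjective _ R.surj

lemma ev_lift (g : MvPolynomial (Fin n) K) : Ev fun R => ∃ gA, inc n R gA = g := by
  classical
  refine ⟨g.support.image fun c => coeff c g, fun R hR => ?_⟩
  have : ∀ c ∈ g.support, ∃ a, R.incl a = coeff c g := fun c hc =>
    hR _ (Finset.mem_image_of_mem _ hc)
  choose! a ha using this
  refine ⟨∑ c ∈ g.support, monomial c (a c), ?_⟩
  rw [map_sum]
  conv_rhs => rw [g.as_sum]
  refine Finset.sum_congr rfl fun c hc => ?_
  rw [map_monomial, ha c hc]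

/-- The reduction of an ideal. -/
noncomputable def redI (R : Red K) (I : Ideal (MvPolynomial (Fin n) K)) :
    Ideal (MvPolynomial (Fin n) R.k) :=
  (I.comap (inc n R)).map (rd n R)

lemma mem_redI {R : Red K} {I : Ideal (MvPolynomial (Fin n) K)} {g} :
    g ∈ redI R I ↔ ∃ q, inc n R q ∈ I ∧ rd n R q = g := by
  rw [redI, Ideal.mem_map_iff_of_surjective _ (rd_surj R)]
  rfl

lemma redI_mono {R : Red K} {I J : Ideal (MvPolynomial (Fin n) K)} (h : I ≤ J) :
    redI R I ≤ redI R J := Ideal.map_mono (Ideal.comap_mono h)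

lemma gb_div (m : MonomialOrder (Fin n)) (R : Red K) (L : Ideal (MvPolynomial (Fin n) K))
    {r : ℕ} (h : Fin r → MvPolynomial (Fin n) K) (E : Fin r → (Fin n →₀ ℕ))
    (hL : ∀ i, h i ∈ L) (hE : ∀ i, Mon m (E i) (h i))
    (hgb : ∀ g ∈ L, g ≠ 0 → ∃ i, E i ≤ m.degree g)
    (hA : Fin r → MvPolynomial (Fin n) R.A) (hhA : ∀ i, inc n R (hA i) = h i) :
    (∀ q, inc n R q ∈ L → ∃ a : Fin r → MvPolynomial (Fin n) R.A,
      q = ∑ i, a i * hA i ∧ (rd n R q = 0 → ∀ i, rd n R (a i) = 0)) ∧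
    (∀ q D, inc n R q ∈ L → R.red (coeff D q) = 1 →
      (∀ c, m.toSyn D < m.toSyn c → R.red (coeff c q) = 0) → ∃ i, E i ≤ D) := by
  have : Nontrivial R.A := R.red.domain_nontrivial
  obtain ⟨Q, N, h1, h2, h3, h4⟩ := lin_div (m := m) hA E fun i =>
    Mon.of_map R.incl R.inj (by rw [hhA i]; exact hE i)
  have key : ∀ q, inc n R q ∈ L →
      q = ∑ i, (∑ c ∈ q.support, C (coeff c q) * Q i c) * hA i ∧
      ∑ c ∈ q.support, C (coeff c q) * N c = 0 := by
    intro q hq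
    have e1 : q = ∑ i, (∑ c ∈ q.support, C (coeff c q) * Q i c) * hA i +
        ∑ c ∈ q.support, C (coeff c q) * N c := by
      conv_lhs => rw [q.as_sum]
      simp_rw [Finset.sum_mul]
      rw [Finset.sum_comm, ← Finset.sum_add_distrib]
      refine Finset.sum_congr rfl fun c _ => ?_
      have : monomial c (coeff c q) = C (coeff c q) * monomial c 1 := by
        rw [C_mul_monomial, mul_one]
      rw [this, h1 c, mul_add, Finset.mul_sum]
      simp_rw [mul_assoc]
    have e2 : ∑ c ∈ q.support, C (coeff c q) * N c = 0 := by
      by_contra h0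
      set M := ∑ c ∈ q.support, C (coeff c q) * N c with hM
      have hML : inc n R M ∈ L := by
        have : inc n R M = inc n R q -
            ∑ i, inc n R (∑ c ∈ q.support, C (coeff c q) * Q i c) * h i := by
          have e3 := congrArg (inc n R) e1
          rw [map_add, map_sum] at e3
          rw [e3, eq_sub_iff_add_eq, add_comm]
          congr 1
          exact Finset.sum_congr rfl fun i _ => by rw [map_mul, hhA]
        rw [this]
        exact L.sub_mem hq (L.sum_mem fun i _ => L.mul_mem_left _ (hL i))
      have h0' : inc n R M ≠ 0 := fun h => h0 (inc_inj R (by rw [h, map_zero]))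
      obtain ⟨i, hi⟩ := hgb _ hML h0'
      have hs := support_map_subset _ _ (m.degree_mem_support h0')
      rw [mem_support_iff, hM, coeff_sum] at hs
      obtain ⟨c, _, hc⟩ := Finset.exists_ne_zero_of_sum_ne_zero hs
      rw [coeff_C_mul] at hc
      exact h2 c _ (mem_support_iff.2 (right_ne_zero_of_mul hc)) i hi
    exact ⟨by rwa [e2, add_zero] at e1, e2⟩
  refine ⟨fun q hq => ⟨_, (key q hq).1, fun h0 i => ?_⟩, fun q D hq hD hlt => ?_⟩
  · rw [map_sum]
    refine Finset.sum_eq_zero fun c _ => ?_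
    rw [map_mul, map_C, ← coeff_map, h0, coeff_zero, map_zero, zero_mul]
  · by_contra! hno
    have h0 := congrArg (fun g => R.red (coeff D g)) (key q hq).2
    simp only [coeff_sum, coeff_C_mul, map_sum, map_mul, coeff_zero, map_zero] at h0
    have hDq : D ∈ q.support := by
      rw [mem_support_iff]
      intro h
      rw [h, map_zero] at hD
      exact zero_ne_one hD
    rw [Finset.sum_eq_single_of_mem D hDq] at h0
    · rw [h4 D hno, coeff_monomial, if_pos rfl, map_one, hD, mul_one] at h0
      exact one_ne_zero h0
    · intro c _ hcD
      rcases lt_or_ge (m.toSyn D) (m.toSyn c) with hl | hl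
      · rw [hlt c hl, zero_mul]
      · have : coeff D (N c) = 0 := by
          by_contra hne
          have := h3 c D (mem_support_iff.2 hne)
          exact hcD (m.toSyn.injective (le_antisymm hl this))
        rw [this, map_zero, mul_zero]

/-- Decomposition in `I + (j)`. -/
lemma ev_sup_span (m : MonomialOrder (Fin n)) (I : Ideal (MvPolynomial (Fin n) K))
    (j : MvPolynomial (Fin n) K) :
    Ev fun R : Red K => ∀ jA, inc n R jA = j → ∀ q, inc n R q ∈ I ⊔ Ideal.span {j} →
      ∃ u w, inc n R u ∈ I ∧ q = u + w * jA ∧ (rd n R q = 0 → rd n R w = 0) := by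
  obtain ⟨r, h, E, hL, hE, hgb⟩ := exists_gb m (I ⊔ Ideal.span {j})
  have hd : ∀ i, ∃ u w, u ∈ I ∧ h i = u + w * j := by
    intro i
    obtain ⟨u, hu, v, hv, e⟩ := Submodule.mem_sup.1 (hL i)
    obtain ⟨w, rfl⟩ := Ideal.mem_span_singleton'.1 hv
    exact ⟨u, w, hu, e.symm⟩
  choose u w hu huw using hd
  refine ((Ev.forall fun i => ev_lift (u i)).and (Ev.forall fun i => ev_lift (w i))).mono ?_
  rintro R ⟨hu', hw'⟩ jA hj q hq
  choose uA huA using hu'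
  choose wA hwA using hw'
  obtain ⟨a, e, ha⟩ := (gb_div m R _ h E hL hE hgb (fun i => uA i + wA i * jA) (fun i => by
    rw [map_add, map_mul, huA, hwA, hj, huw])).1 q hq
  refine ⟨∑ i, a i * uA i, ∑ i, a i * wA i, ?_, ?_, fun h0 => ?_⟩
  · rw [map_sum]
    refine I.sum_mem fun i _ => ?_
    rw [map_mul, huA]
    exact I.mul_mem_left _ (hu i)
  · rw [e, Finset.sum_mul, ← Finset.sum_add_distrib]
    exact Finset.sum_congr rfl fun i _ => by ring
  · rw [map_sum]
    exact Finset.sum_eq_zero fun i _ => by rw [map_mul, ha h0 i, zero_mul]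

/-- Decomposition in `I + J`. -/
lemma ev_sup (m : MonomialOrder (Fin n)) (I J : Ideal (MvPolynomial (Fin n) K)) :
    Ev fun R : Red K => ∀ q, inc n R q ∈ I ⊔ J →
      ∃ u v, inc n R u ∈ I ∧ inc n R v ∈ J ∧ q = u + v ∧ (rd n R q = 0 → rd n R u = 0) := by
  obtain ⟨r, h, E, hL, hE, hgb⟩ := exists_gb m (I ⊔ J)
  have hd : ∀ i, ∃ u v, u ∈ I ∧ v ∈ J ∧ h i = u + v := by
    intro i
    obtain ⟨u, hu, v, hv, e⟩ := Submodule.mem_sup.1 (hL i)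
    exact ⟨u, v, hu, hv, e.symm⟩
  choose u w hu hw huw using hd
  refine ((Ev.forall fun i => ev_lift (u i)).and (Ev.forall fun i => ev_lift (w i))).mono ?_
  rintro R ⟨hu', hw'⟩ q hq
  choose uA huA using hu'
  choose wA hwA using hw'
  obtain ⟨a, e, ha⟩ := (gb_div m R _ h E hL hE hgb (fun i => uA i + wA i) (fun i => by
    rw [map_add, huA, hwA, huw])).1 q hq
  refine ⟨∑ i, a i * uA i, ∑ i, a i * wA i, ?_, ?_, ?_, fun h0 => ?_⟩
  · rw [map_sum]
    refine I.sum_mem fun i _ => ?_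
    rw [map_mul, huA]
    exact I.mul_mem_left _ (hu i)
  · rw [map_sum]
    refine J.sum_mem fun i _ => ?_
    rw [map_mul, hwA]
    exact J.mul_mem_left _ (hw i)
  · rw [e, ← Finset.sum_add_distrib]
    exact Finset.sum_congr rfl fun i _ => by ring
  · rw [map_sum]
    exact Finset.sum_eq_zero fun i _ => by rw [map_mul, ha h0 i, zero_mul]

lemma ev_redI_sup (m : MonomialOrder (Fin n)) (I J : Ideal (MvPolynomial (Fin n) K)) :
    Ev fun R : Red K => redI R (I ⊔ J) ≤ redI R I ⊔ redI R J := by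
  refine (ev_sup m I J).mono fun R hR g hg => ?_
  obtain ⟨q, hq, rfl⟩ := mem_redI.1 hg
  obtain ⟨u, v, hu, hv, rfl, _⟩ := hR q hq
  rw [map_add]
  exact Submodule.add_mem_sup (mem_redI.2 ⟨u, hu, rfl⟩) (mem_redI.2 ⟨v, hv, rfl⟩)

lemma ev_redI_inf (m : MonomialOrder (Fin n)) (I J : Ideal (MvPolynomial (Fin n) K)) :
    Ev fun R : Red K => redI R I ⊓ redI R J ≤ redI R (I ⊓ J) := by
  refine (ev_sup m I J).mono fun R hR g hg => ?_
  obtain ⟨a, ha, rfl⟩ := mem_redI.1 hg.1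
  obtain ⟨b, hb, hab⟩ := mem_redI.1 hg.2
  obtain ⟨u, v, hu, hv, e, h0⟩ := hR (a - b) (by
    rw [map_sub]
    exact Submodule.sub_mem _ (Submodule.mem_sup_left ha) (Submodule.mem_sup_right hb))
  refine mem_redI.2 ⟨a - u, ⟨?_, ?_⟩, ?_⟩
  · rw [map_sub]; exact I.sub_mem ha hu
  · have : a - u = b + v := by linear_combination e
    rw [this, map_add]; exact J.add_mem hb hv
  · rw [map_sub, h0 (by rw [map_sub, hab, sub_self]), sub_zero]

lemma ev_redI_colon_single (m : MonomialOrder (Fin n)) (I : Ideal (MvPolynomial (Fin n) K))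
    (j : MvPolynomial (Fin n) K) :
    Ev fun R : Red K => ∀ jA, inc n R jA = j → ∀ g, g * rd n R jA ∈ redI R I →
      g ∈ redI R (I.colon {j}) := by
  refine (ev_sup_span m I j).mono fun R hR jA hj g hg => ?_
  obtain ⟨a, ha, e⟩ := mem_redI.1 hg
  obtain ⟨G, rfl⟩ := rd_surj R g
  obtain ⟨u, w, hu, e', h0⟩ := hR jA hj (G * jA - a) (by
    rw [map_sub, map_mul, hj]
    exact Submodule.sub_mem _ (Submodule.mem_sup_right
      (Ideal.mul_mem_left _ _ (Ideal.mem_span_singleton_self j))) (Submodule.mem_sup_left ha))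
  refine mem_redI.2 ⟨G - w, ?_, ?_⟩
  · rw [Submodule.mem_colon_singleton, smul_eq_mul, ← hj, ← map_mul]
    have : (G - w) * jA = a + u := by linear_combination e'
    rw [this, map_add]
    exact I.add_mem ha hu
  · rw [map_sub, h0 (by rw [map_sub, map_mul, e, sub_self]), sub_zero]

lemma ev_redI_colon (m : MonomialOrder (Fin n)) (I : Ideal (MvPolynomial (Fin n) K))
    (s : Finset (MvPolynomial (Fin n) K)) :
    Ev fun R : Red K => ∀ g, (∀ j ∈ s, ∀ jA, inc n R jA = j → g * rd n R jA ∈ redI R I) →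
      g ∈ redI R (I.colon (s : Set (MvPolynomial (Fin n) K))) := by
  classical
  induction s using Finset.induction_on with
  | empty =>
    refine ⟨∅, fun R _ g _ => ?_⟩
    obtain ⟨G, rfl⟩ := rd_surj R g
    exact mem_redI.2 ⟨G, by simp, rfl⟩
  | insert j s _ ih =>
    refine (((ih.and (ev_redI_colon_single m I j)).and (ev_lift j)).and
      (ev_redI_inf m (I.colon {j}) (I.colon (s : Set (MvPolynomial (Fin n) K))))).mono ?_
    rintro R ⟨⟨⟨h1, h2⟩, jA, hj⟩, h3⟩ g hg
    rw [Finset.coe_insert, Set.insert_eq, Submodule.colon_union]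
    exact h3 ⟨h2 jA hj g (hg j (Finset.mem_insert_self _ _) jA hj),
      h1 g fun j' hj' => hg j' (Finset.mem_insert_of_mem hj')⟩

end ev

section main
variable {K : Type u} [Field K]

/-- Compatibility of the reduction with the trace map. -/
def Compat (F : MvPolynomial (Fin n) K) (I : Ideal (MvPolynomial (Fin n) K)) (R : Red K) : Prop :=
  ∀ FA, inc n R FA = F → ∀ g ∈ redI R I, tr R (rd n R FA ^ (R.p - 1) * g) ∈ redI R I

lemma ev_compat (m : MonomialOrder (Fin n)) (f μ : MvPolynomial (Fin n) K)
    {I : Ideal (MvPolynomial (Fin n) K)} (hI : KnutsonFamily f I) :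
    Ev (Compat (f * μ) I) := by
  induction hI with
  | base =>
    refine (((ev_sup_span m ⊥ f).and (ev_lift f)).and (ev_lift μ)).mono ?_
    rintro R ⟨⟨h1, fA, hf⟩, μA, hμ⟩ FA hFA g hg
    obtain ⟨q, hq, rfl⟩ := mem_redI.1 hg
    obtain ⟨u, w, hu, rfl, -⟩ := h1 fA hf q (Submodule.mem_sup_right hq)
    obtain rfl : u = 0 := inc_inj R (by rw [map_zero]; exact hu)
    obtain rfl : FA = fA * μA := inc_inj R (by rw [hFA, map_mul, hf, hμ])
    have : rd n R (fA * μA) ^ (R.p - 1) * rd n R (0 + w * fA) =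
        rd n R fA ^ R.p * (rd n R μA ^ (R.p - 1) * rd n R w) := by
      obtain ⟨k, hk⟩ := Nat.exists_eq_succ_of_ne_zero R.hp.ne_zero
      rw [hk, Nat.succ_sub_one, zero_add, map_mul, map_mul, pow_succ]
      ring
    rw [this, tr_pow_mul]
    exact Ideal.mul_mem_right _ _
      (mem_redI.2 ⟨fA, by rw [hf]; exact Ideal.mem_span_singleton_self f, rfl⟩)
  | colon I J _ ih =>
    obtain ⟨s, rfl⟩ := IsNoetherian.noetherian J
    rw [Submodule.colon_span]
    refine (ih.and (ev_redI_colon m I s)).mono ?_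
    rintro R ⟨h1, h2⟩ FA hFA g hg
    refine h2 _ fun j hj jA hjA => ?_
    have e : tr R (rd n R FA ^ (R.p - 1) * g) * rd n R jA =
        tr R (rd n R FA ^ (R.p - 1) * (g * rd n R jA ^ R.p)) := by
      rw [mul_comm _ (rd n R jA), ← tr_pow_mul]
      congr 1
      ring
    rw [e]
    apply h1 FA hFA
    obtain ⟨k, hk⟩ := Nat.exists_eq_succ_of_ne_zero R.hp.ne_zero
    rw [hk, pow_succ', ← mul_assoc]
    apply Ideal.mul_mem_right
    obtain ⟨q, hq, rfl⟩ := mem_redI.1 hg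
    rw [← map_mul]
    refine mem_redI.2 ⟨_, ?_, rfl⟩
    rw [map_mul, hjA]
    exact Submodule.mem_colon.1 hq j hj
  | add I J _ _ ihI ihJ =>
    refine ((ihI.and ihJ).and (ev_redI_sup m I J)).mono ?_
    rintro R ⟨⟨h1, h2⟩, h3⟩ FA hFA g hg
    obtain ⟨a, ha, b, hb, rfl⟩ := Submodule.mem_sup.1 (h3 hg)
    rw [mul_add, tr_add]
    exact Ideal.add_mem _ (redI_mono le_sup_left (h1 FA hFA a ha))
      (redI_mono le_sup_right (h2 FA hFA b hb))
  | inter I J _ _ ihI ihJ =>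
    refine ((ihI.and ihJ).and (ev_redI_inf m I J)).mono ?_
    rintro R ⟨⟨h1, h2⟩, h3⟩ FA hFA g hg
    exact h3 ⟨h1 FA hFA g (redI_mono inf_le_left hg), h2 FA hFA g (redI_mono inf_le_right hg)⟩

lemma radical_aux {m : MonomialOrder (Fin n)} {F : MvPolynomial (Fin n) K}
    (hF : Mon m (Finsupp.equivFunOnFinite.symm (fun _ => 1)) F)
    {I : Ideal (MvPolynomial (Fin n) K)} (hI : Ev (Compat F I))
    {g : MvPolynomial (Fin n) K} (hg : g ∈ I) {D : Fin n →₀ ℕ} (hD : Mon m (2 • D) g) :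
    ∃ h ∈ I, Mon m D h := by
  obtain ⟨r, h, E, hL, hE, hgb⟩ := exists_gb m I
  obtain ⟨R, ⟨⟨h1, FA, hFA⟩, gA, hgA⟩, h4⟩ := (((hI.and (ev_lift F)).and (ev_lift g)).and
    (Ev.forall fun i => ev_lift (h i))).exists
  choose hA hhA using h4
  have mF : Mon m (Finsupp.equivFunOnFinite.symm (fun _ => 1)) (rd n R FA) :=
    (Mon.of_map R.incl R.inj (by rw [hFA]; exact hF)).map R.red
  have mg : Mon m (2 • D) (rd n R gA) :=
    (Mon.of_map R.incl R.inj (by rw [hgA]; exact hD)).map R.red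
  have mG : Mon m (R.p • D) (rd n R gA * monomial ((R.p - 2) • D) 1) := by
    have := mg.mul (mon_monomial (m := m) (R := R.k) ((R.p - 2) • D))
    rwa [← add_nsmul, Nat.add_sub_cancel' R.hp.two_le] at this
  have hmem : rd n R gA * monomial ((R.p - 2) • D) 1 ∈ redI R I :=
    Ideal.mul_mem_right _ _ (mem_redI.2 ⟨gA, by rw [hgA]; exact hg, rfl⟩)
  have mT := tr_mon R mF mG
  obtain ⟨q, hq, e⟩ := mem_redI.1 (h1 FA hFA _ hmem)
  rw [← e] at mT
  obtain ⟨i, hi⟩ := (gb_div m R I h E hL hE hgb hA hhA).2 q D hq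
    (by rw [← coeff_map]; exact mT.1)
    (fun c hc => by rw [← coeff_map]; exact m.coeff_eq_zero_of_lt (mT.2.trans_lt hc))
  refine ⟨h i * monomial (D - E i) 1, I.mul_mem_right _ (hL i), ?_⟩
  have := (hE i).mul (mon_monomial (m := m) (R := K) (D - E i))
  rwa [add_tsub_cancel_of_le hi] at this

lemma knutson_radical {m : MonomialOrder (Fin n)} {f : MvPolynomial (Fin n) K}
    (hf : m.HasSqfreeLeadTerm f)
    {I : Ideal (MvPolynomial (Fin n) K)} (hI : KnutsonFamily f I)
    {g : MvPolynomial (Fin n) K} (hg : g ∈ I) {D : Fin n →₀ ℕ} (hD : Mon m (2 • D) g) :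
    ∃ h ∈ I, Mon m D h := by
  obtain ⟨hf0, hf1⟩ := hf
  have hf1' : ∀ i, m.degree f i ≤ 1 := hf1
  have e : (Finsupp.equivFunOnFinite.symm (fun _ => 1) : Fin n →₀ ℕ) = m.degree f +
      (Finsupp.equivFunOnFinite.symm (fun _ => 1) - m.degree f) := by
    rw [add_tsub_cancel_of_le]
    intro i
    simpa using hf1' i
  refine radical_aux (F := f * (C (coeff (m.degree f) f)⁻¹ *
    monomial (Finsupp.equivFunOnFinite.symm (fun _ => 1) - m.degree f) 1)) ?_
    (ev_compat m f _ hI) hg hD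
  rw [e]
  have := (exists_mon (m := m) hf0).mul (mon_monomial (m := m) (R := K)
    (Finsupp.equivFunOnFinite.symm (fun _ => 1) - m.degree f))
  rw [← e]
  rw [← e] at this
  convert this using 1
  ring

lemma lead_mem_init {m : MonomialOrder (Fin n)} {I : Ideal (MvPolynomial (Fin n) K)}
    {a : MvPolynomial (Fin n) K} (ha : a ∈ I) {D : Fin n →₀ ℕ}
    (hD : m.toSyn (m.degree a) ≤ m.toSyn D) :
    monomial D (coeff D a) ∈ m.initialIdeal I := by
  by_cases h0 : coeff D a = 0
  · rw [h0, map_zero]; exact Ideal.zero_mem _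
  · have : m.degree a = D := m.toSyn.injective
      (le_antisymm hD (m.le_degree (mem_support_iff.2 h0)))
    refine Ideal.subset_span ⟨a, ha, fun h => h0 (by rw [h, coeff_zero]), ?_⟩
    subst this
    rfl

lemma sum_aux {m : MonomialOrder (Fin n)} {f : MvPolynomial (Fin n) K}
    (hf : m.HasSqfreeLeadTerm f)
    {I J : Ideal (MvPolynomial (Fin n) K)} (hI : KnutsonFamily f I) (hJ : KnutsonFamily f J)
    (s : m.syn) : ∀ D, m.toSyn D = s → ∀ a ∈ I, ∀ b ∈ J, m.toSyn (m.degree a) ≤ m.toSyn D →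
      m.toSyn (m.degree b) ≤ m.toSyn D → a + b ≠ 0 →
      m.leadTerm (a + b) ∈ m.initialIdeal I + m.initialIdeal J := by
  induction s using WellFoundedLT.induction with
  | ind s ih =>
  rintro D rfl a ha b hb hDa hDb h0
  by_cases hD : coeff D (a + b) = 0
  · -- cancellation: lower `D`
    obtain ⟨a', b', ha', hb', e, hca, hcb, hla, hlb⟩ : ∃ a' b', a' ∈ I ∧ b' ∈ J ∧
        a + b = a' + b' ∧ coeff D a' = 0 ∧ coeff D b' = 0 ∧
        m.toSyn (m.degree a') ≤ m.toSyn D ∧ m.toSyn (m.degree b') ≤ m.toSyn D := by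
      by_cases hz : coeff D a = 0
      · rw [coeff_add, hz, zero_add] at hD
        exact ⟨a, b, ha, hb, rfl, hz, hD, hDa, hDb⟩
      · have hzb : coeff D b = - coeff D a := by
          rw [coeff_add] at hD
          linear_combination hD
        have hda : Mon m D (C (coeff D a)⁻¹ * a) := by
          have e1 : m.degree a = D := m.toSyn.injective
            (le_antisymm hDa (m.le_degree (mem_support_iff.2 hz)))
          have := exists_mon (m := m) (g := a) (fun h => hz (by rw [h, coeff_zero]))
          rwa [e1] at this
        have hzb0 : coeff D b ≠ 0 := by rw [hzb]; exact neg_ne_zero.2 hz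
        have hdb : Mon m D (C (coeff D b)⁻¹ * b) := by
          have e1 : m.degree b = D := m.toSyn.injective
            (le_antisymm hDb (m.le_degree (mem_support_iff.2 hzb0)))
          have := exists_mon (m := m) (g := b) (fun h => hzb0 (by rw [h, coeff_zero]))
          rwa [e1] at this
        have hmul := hda.mul hdb
        rw [← two_nsmul] at hmul
        obtain ⟨c, hc, mc⟩ := knutson_radical hf (KnutsonFamily.inter I J hI hJ)
          ⟨I.mul_mem_right _ (I.mul_mem_left _ ha), J.mul_mem_left _ (J.mul_mem_left _ hb)⟩ hmul
        have hdeg : m.toSyn (m.degree (C (coeff D a) * c)) ≤ m.toSyn D := by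
          rw [m.degree_le_iff]
          intro d hd
          rw [mem_support_iff, coeff_C_mul] at hd
          exact m.degree_le_iff.1 mc.2 d (mem_support_iff.2 (right_ne_zero_of_mul hd))
        refine ⟨a - C (coeff D a) * c, b + C (coeff D a) * c,
          I.sub_mem ha (I.mul_mem_left _ hc.1), J.add_mem hb (J.mul_mem_left _ hc.2),
          by ring, ?_, ?_, ?_, ?_⟩
        · rw [coeff_sub, coeff_C_mul, mc.1, mul_one, sub_self]
        · rw [coeff_add, coeff_C_mul, mc.1, mul_one, hzb, neg_add_cancel]
        · exact m.degree_sub_le.trans (sup_le hDa hdeg)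
        · exact m.degree_add_le.trans (sup_le hDb hdeg)
    -- now both have support strictly below `D`
    have hlt : ∀ g : MvPolynomial (Fin n) K, coeff D g = 0 → m.toSyn (m.degree g) ≤ m.toSyn D →
        g ≠ 0 → m.toSyn (m.degree g) < m.toSyn D := by
      intro g hg hle hg0
      refine lt_of_le_of_ne hle fun h => ?_
      have := m.toSyn.injective h
      rw [← this] at hg
      exact m.coeff_degree_ne_zero_iff.2 hg0 hg
    rw [e] at h0 ⊢
    by_cases ha0 : a' = 0
    · have hb0 : b' ≠ 0 := by rintro rfl; exact h0 (by rw [ha0, add_zero])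
      rw [ha0, zero_add]
      exact Submodule.mem_sup_right (Ideal.subset_span ⟨b', hb', hb0, rfl⟩)
    by_cases hb0 : b' = 0
    · rw [hb0, add_zero]
      exact Submodule.mem_sup_left (Ideal.subset_span ⟨a', ha', ha0, rfl⟩)
    rcases le_total (m.toSyn (m.degree a')) (m.toSyn (m.degree b')) with hl | hl
    · exact ih _ (hlt b' hcb hlb hb0) _ rfl a' ha' b' hb' hl le_rfl h0
    · exact ih _ (hlt a' hca hla ha0) _ rfl a' ha' b' hb' le_rfl hl h0
  · have e1 : m.degree (a + b) = D := m.toSyn.injective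
      (le_antisymm (m.degree_add_le.trans (sup_le hDa hDb))
        (m.le_degree (mem_support_iff.2 hD)))
    have e2 : m.leadTerm (a + b) = monomial D (coeff D a) + monomial D (coeff D b) := by
      rw [← map_add, ← coeff_add]
      conv_rhs => rw [← e1]
      rfl
    rw [e2]
    exact Submodule.add_mem_sup (lead_mem_init ha hDa) (lead_mem_init hb hDb)

end main

end KnutsonAux

/-- **Theorem (Gröbner bases of sums).** If `f` has squarefree leading term and
`I, J ∈ C_f`, then `lt(I + J) = lt(I) + lt(J)` (equivalently, the union of Gröbner bases
of `I` and `J` is a Gröbner basis of `I + J`). -/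
theorem initialIdeal_add_of_knutson {n : ℕ} {K : Type*} [Field K]
    (m : MonomialOrder (Fin n)) (f : MvPolynomial (Fin n) K)
    (hf : m.HasSqfreeLeadTerm f)
    (I J : Ideal (MvPolynomial (Fin n) K))
    (hI : KnutsonFamily f I) (hJ : KnutsonFamily f J) :
    m.initialIdeal (I + J) = m.initialIdeal I + m.initialIdeal J := by
  apply le_antisymm
  · rw [MonomialOrder.initialIdeal, Ideal.span_le]
    rintro g ⟨h, hh, h0, rfl⟩
    obtain ⟨a, ha, b, hb, rfl⟩ := Submodule.mem_sup.1 hh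
    rcases le_total (m.toSyn (m.degree a)) (m.toSyn (m.degree b)) with hl | hl
    · exact KnutsonAux.sum_aux hf hI hJ _ (m.degree b) rfl a ha b hb hl le_rfl h0
    · exact KnutsonAux.sum_aux hf hI hJ _ (m.degree a) rfl a ha b hb le_rfl hl h0
  · apply sup_le
    · apply Ideal.span_mono
      rintro g ⟨h, hh, h0, rfl⟩
      exact ⟨h, Submodule.mem_sup_left hh, h0, rfl⟩
    · apply Ideal.span_mono
      rintro g ⟨h, hh, h0, rfl⟩
      exact ⟨h, Submodule.mem_sup_right hh, h0, rfl⟩
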